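/- arXiv:1710.02739 — 4 statements merged into one kernel-verified Lean document; each statement's English description precedes it below -/
import Mathlib

section
/- Let s ∈ {1,−1}, let p be a positive integer, and let v : ℝ³ → ℝ be a smooth function of (t,x,y) solving the gKP potential equation v_{tx} + (v_x)^p v_{xx} + v_{xxxx} + s·v_{yy} = 0 at every point. Define T = (1/2)v_x·v_y, X = v_y·v_{xxx} − v_{xx}·v_{xy} + v_y·v_x^{p+1}/(p+1) + (1/2)v_t·v_y, Y = (1/2)v_{xx}² + (1/2)s·v_y² − v_x^{p+2}/((p+1)(p+2)) − (1/2)v_t·v_x. Then ∂_t T + ∂_x X + ∂_y Y = 0 at every point (this is the y-momentum conservation law of the gKP equation, arising from y-translation invariance). -/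
/-- Partial derivative with respect to the first (time) variable. -/
noncomputable def pdt (v : ℝ → ℝ → ℝ → ℝ) (t x y : ℝ) : ℝ :=
  deriv (fun t' => v t' x y) t

/-- Partial derivative with respect to the second (x) variable. -/
noncomputable def pdx (v : ℝ → ℝ → ℝ → ℝ) (t x y : ℝ) : ℝ :=
  deriv (fun x' => v t x' y) x

/-- Partial derivative with respect to the third (y) variable. -/
noncomputable def pdy (v : ℝ → ℝ → ℝ → ℝ) (t x y : ℝ) : ℝ :=
  deriv (fun y' => v t x y') y


/-- Smoothness of a function of three real variables in curried form. -/
def SmoothCurried (v : ℝ → ℝ → ℝ → ℝ) : Prop :=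
  ContDiff ℝ (⊤ : ℕ∞) (fun q : ℝ × ℝ × ℝ => v q.1 q.2.1 q.2.2)

namespace SmoothCurried

variable {v : ℝ → ℝ → ℝ → ℝ}

theorem hasFDerivAt (hv : SmoothCurried v) (q : ℝ × ℝ × ℝ) :
    HasFDerivAt (fun q : ℝ × ℝ × ℝ => v q.1 q.2.1 q.2.2)
      (fderiv ℝ (fun q : ℝ × ℝ × ℝ => v q.1 q.2.1 q.2.2) q) q :=
  (ContDiff.differentiable hv (by simp) q).hasFDerivAt

theorem hasDerivAt_fderiv_t (hv : SmoothCurried v) (t x y : ℝ) :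
    HasDerivAt (fun t' => v t' x y)
      (fderiv ℝ (fun q : ℝ × ℝ × ℝ => v q.1 q.2.1 q.2.2) (t, x, y) (1, 0, 0)) t :=
  HasFDerivAt.comp_hasDerivAt (f := fun t' => (t', x, y)) t (hv.hasFDerivAt (t, x, y))
    ((hasDerivAt_id t).prodMk ((hasDerivAt_const t x).prodMk (hasDerivAt_const t y)))

theorem hasDerivAt_fderiv_x (hv : SmoothCurried v) (t x y : ℝ) :
    HasDerivAt (fun x' => v t x' y)
      (fderiv ℝ (fun q : ℝ × ℝ × ℝ => v q.1 q.2.1 q.2.2) (t, x, y) (0, 1, 0)) x :=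
  HasFDerivAt.comp_hasDerivAt (f := fun x' => (t, x', y)) x (hv.hasFDerivAt (t, x, y))
    ((hasDerivAt_const x t).prodMk ((hasDerivAt_id x).prodMk (hasDerivAt_const x y)))

theorem hasDerivAt_fderiv_y (hv : SmoothCurried v) (t x y : ℝ) :
    HasDerivAt (fun y' => v t x y')
      (fderiv ℝ (fun q : ℝ × ℝ × ℝ => v q.1 q.2.1 q.2.2) (t, x, y) (0, 0, 1)) y :=
  HasFDerivAt.comp_hasDerivAt (f := fun y' => (t, x, y')) y (hv.hasFDerivAt (t, x, y))
    ((hasDerivAt_const y t).prodMk ((hasDerivAt_const y x).prodMk (hasDerivAt_id y)))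

theorem hasDerivAt_t (hv : SmoothCurried v) (t x y : ℝ) :
    HasDerivAt (fun t' => v t' x y) (pdt v t x y) t :=
  (hv.hasDerivAt_fderiv_t t x y).differentiableAt.hasDerivAt

theorem hasDerivAt_x (hv : SmoothCurried v) (t x y : ℝ) :
    HasDerivAt (fun x' => v t x' y) (pdx v t x y) x :=
  (hv.hasDerivAt_fderiv_x t x y).differentiableAt.hasDerivAt

theorem hasDerivAt_y (hv : SmoothCurried v) (t x y : ℝ) :
    HasDerivAt (fun y' => v t x y') (pdy v t x y) y :=
  (hv.hasDerivAt_fderiv_y t x y).differentiableAt.hasDerivAt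

theorem pdt_eq (hv : SmoothCurried v) (t x y : ℝ) : pdt v t x y =
    fderiv ℝ (fun q : ℝ × ℝ × ℝ => v q.1 q.2.1 q.2.2) (t, x, y) (1, 0, 0) :=
  (hv.hasDerivAt_fderiv_t t x y).deriv

theorem pdx_eq (hv : SmoothCurried v) (t x y : ℝ) : pdx v t x y =
    fderiv ℝ (fun q : ℝ × ℝ × ℝ => v q.1 q.2.1 q.2.2) (t, x, y) (0, 1, 0) :=
  (hv.hasDerivAt_fderiv_x t x y).deriv

theorem pdy_eq (hv : SmoothCurried v) (t x y : ℝ) : pdy v t x y =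
    fderiv ℝ (fun q : ℝ × ℝ × ℝ => v q.1 q.2.1 q.2.2) (t, x, y) (0, 0, 1) :=
  (hv.hasDerivAt_fderiv_y t x y).deriv

theorem contDiff_fderiv_apply (hv : SmoothCurried v) (a : ℝ × ℝ × ℝ) :
    ContDiff ℝ (⊤ : ℕ∞)
      (fun q => fderiv ℝ (fun q : ℝ × ℝ × ℝ => v q.1 q.2.1 q.2.2) q a) :=
  (ContDiff.fderiv_right hv (by simp)).clm_apply contDiff_const

protected theorem pdt (hv : SmoothCurried v) : SmoothCurried (pdt v) := by
  simpa only [SmoothCurried, hv.pdt_eq] using hv.contDiff_fderiv_apply (1, 0, 0)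

protected theorem pdx (hv : SmoothCurried v) : SmoothCurried (pdx v) := by
  simpa only [SmoothCurried, hv.pdx_eq] using hv.contDiff_fderiv_apply (0, 1, 0)

protected theorem pdy (hv : SmoothCurried v) : SmoothCurried (pdy v) := by
  simpa only [SmoothCurried, hv.pdy_eq] using hv.contDiff_fderiv_apply (0, 0, 1)

theorem fderiv_fderiv_apply_comm (hv : SmoothCurried v) (q a b : ℝ × ℝ × ℝ) :
    fderiv ℝ (fun q => fderiv ℝ (fun q : ℝ × ℝ × ℝ => v q.1 q.2.1 q.2.2) q a) q b =
      fderiv ℝ (fun q => fderiv ℝ (fun q : ℝ × ℝ × ℝ => v q.1 q.2.1 q.2.2) q b) q a := by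
  have hd : DifferentiableAt ℝ (fderiv ℝ (fun q : ℝ × ℝ × ℝ => v q.1 q.2.1 q.2.2)) q :=
    (ContDiff.fderiv_right (m := 1) hv (by norm_cast)).differentiable (by simp) q
  have hs := (ContDiff.contDiffAt hv (x := q)).isSymmSndFDerivAt 
    (by rw [minSmoothness_of_isRCLikeNormedField]; exact WithTop.coe_le_coe.2 (le_top (a := (2 : ℕ∞))))
  simpa [fderiv_clm_apply hd (differentiableAt_const _)] using hs b a

theorem pdx_pdt_comm (hv : SmoothCurried v) (t x y : ℝ) :
    pdx (pdt v) t x y = pdt (pdx v) t x y := by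
  rw [hv.pdt.pdx_eq, hv.pdx.pdt_eq]
  simpa only [hv.pdt_eq, hv.pdx_eq] using hv.fderiv_fderiv_apply_comm _ _ _

theorem pdy_pdt_comm (hv : SmoothCurried v) (t x y : ℝ) :
    pdy (pdt v) t x y = pdt (pdy v) t x y := by
  rw [hv.pdt.pdy_eq, hv.pdy.pdt_eq]
  simpa only [hv.pdt_eq, hv.pdy_eq] using hv.fderiv_fderiv_apply_comm _ _ _

theorem pdx_pdy_comm (hv : SmoothCurried v) (t x y : ℝ) :
    pdx (pdy v) t x y = pdy (pdx v) t x y := by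
  rw [hv.pdy.pdx_eq, hv.pdx.pdy_eq]
  simpa only [hv.pdy_eq, hv.pdx_eq] using hv.fderiv_fderiv_apply_comm _ _ _

end SmoothCurried

/-- y-momentum conservation law of the gKP equation. -/
theorem gkp_y_momentum_conservation
    (s : ℝ) (hs : s = 1 ∨ s = -1)
    (p : ℕ) (hp : 1 ≤ p)
    (v : ℝ → ℝ → ℝ → ℝ)
    (hv : ContDiff ℝ (⊤ : ℕ∞) (fun q : ℝ × ℝ × ℝ => v q.1 q.2.1 q.2.2))
    (hsol : ∀ t x y : ℝ,
      pdt (pdx v) t x y + (pdx v t x y) ^ p * pdx (pdx v) t x y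
        + pdx (pdx (pdx (pdx v))) t x y + s * pdy (pdy v) t x y = 0)
    (T X Y : ℝ → ℝ → ℝ → ℝ)
    (hT : ∀ t x y : ℝ, T t x y = (1/2) * pdx v t x y * pdy v t x y)
    (hX : ∀ t x y : ℝ, X t x y =
      pdy v t x y * pdx (pdx (pdx v)) t x y - pdx (pdx v) t x y * pdy (pdx v) t x y
        + pdy v t x y * (pdx v t x y) ^ (p+1) / ((p : ℝ) + 1)
        + (1/2) * pdt v t x y * pdy v t x y)
    (hY : ∀ t x y : ℝ, Y t x y =
      (1/2) * (pdx (pdx v) t x y) ^ 2 + (1/2) * s * (pdy v t x y) ^ 2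
        - (pdx v t x y) ^ (p+2) / (((p : ℝ) + 1) * ((p : ℝ) + 2))
        - (1/2) * pdt v t x y * pdx v t x y) :
    ∀ t x y : ℝ, pdt T t x y + pdx X t x y + pdy Y t x y = 0 := by
  intro t x y
  have h : SmoothCurried v := hv
  have hp1 : (p : ℝ) + 1 ≠ 0 := by positivity
  have hp2 : (p : ℝ) + 2 ≠ 0 := by positivity
  have hTt : pdt T t x y = 1 / 2 * pdt (pdx v) t x y * pdy v t x y
      + 1 / 2 * pdx v t x y * pdt (pdy v) t x y := by
    simp only [pdt, hT]
    exact (((h.pdx.hasDerivAt_t t x y).const_mul (1 / 2)).mul (h.pdy.hasDerivAt_t t x y)).deriv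
  have hXx := (((((h.pdy.hasDerivAt_x t x y).mul (h.pdx.pdx.pdx.hasDerivAt_x t x y)).sub
    ((h.pdx.pdx.hasDerivAt_x t x y).mul (h.pdx.pdy.hasDerivAt_x t x y))).add
    (((h.pdy.hasDerivAt_x t x y).mul ((h.pdx.hasDerivAt_x t x y).pow (p + 1))).div_const
      ((p : ℝ) + 1))).add
    (((h.pdt.hasDerivAt_x t x y).const_mul (1 / 2)).mul (h.pdy.hasDerivAt_x t x y))).deriv
  have hYy := ((((((h.pdx.pdx.hasDerivAt_y t x y).pow 2).const_mul (1 / 2)).add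
    (((h.pdy.hasDerivAt_y t x y).pow 2).const_mul (1 / 2 * s))).sub
    (((h.pdx.hasDerivAt_y t x y).pow (p + 2)).div_const (((p : ℝ) + 1) * ((p : ℝ) + 2)))).sub
    (((h.pdt.hasDerivAt_y t x y).const_mul (1 / 2)).mul (h.pdx.hasDerivAt_y t x y))).deriv
  have hX' : (fun x' => X t x' y) = _ := funext fun x' => hX t x' y
  have hY' : (fun y' => Y t x y') = _ := funext fun y' => hY t x y'
  replace hXx := (congrArg (fun f => deriv f x) hX').trans hXx
  replace hYy := (congrArg (fun f => deriv f y) hY').trans hYy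
  change pdx X t x y = _ at hXx
  change pdy Y t x y = _ at hYy
  rw [hTt, hXx, hYy, h.pdx_pdt_comm, h.pdy_pdt_comm, h.pdx_pdy_comm, h.pdx.pdx_pdy_comm]
  have hs0 := hsol t x y
  simp only [Pi.pow_apply, Nat.add_sub_cancel, show p + 2 - 1 = p + 1 from rfl]
  push_cast
  field_simp
  linear_combination (2 * ((p : ℝ) + 1) * pdy v t x y) * hs0
end

section
/- Let s ∈ {1,−1}, e ∈ {1,−1}, let p be a positive integer, and let v : ℝ³ → ℝ be a smooth function of (t,x,y) solving the 2D gB potential equation v_{tt} = v_{xx} + (p+1)(v_x)^p v_{xx} + e·v_{xxxx} + s·v_{yy} at every point. Define T = (1/2)(v_t² − e·v_{xx}² + v_x² + s·v_y²) + v_x^{p+2}/(p+2), X = −(v_x^{p+1} + e·v_{xxx} + v_x)·v_t + e·v_{tx}·v_{xx}, Y = −s·v_t·v_y. Then ∂_t T + ∂_x X + ∂_y Y = 0 at every point (this is the energy conservation law of the 2D generalized Boussinesq equation, arising from time-translation invariance). -/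
/-- The function on `ℝ × ℝ × ℝ` associated with a function of three variables. -/
def uncurryThree (f : ℝ → ℝ → ℝ → ℝ) (q : ℝ × ℝ × ℝ) : ℝ := f q.1 q.2.1 q.2.2

lemma uncurryThree_mk (f : ℝ → ℝ → ℝ → ℝ) (t x y : ℝ) :
    uncurryThree f (t, x, y) = f t x y := rfl

section PartialDerivatives

variable {f : ℝ → ℝ → ℝ → ℝ}

lemma hasDerivAt_fst_of_differentiable (hf : Differentiable ℝ (uncurryThree f)) (t x y : ℝ) :
    HasDerivAt (fun t' => f t' x y) (fderiv ℝ (uncurryThree f) (t, x, y) (1, 0, 0)) t :=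
  HasFDerivAt.comp_hasDerivAt (f := fun t' => (t', x, y)) t (hf (t, x, y)).hasFDerivAt
    ((hasDerivAt_id t).prodMk ((hasDerivAt_const t x).prodMk (hasDerivAt_const t y)))

lemma hasDerivAt_snd_of_differentiable (hf : Differentiable ℝ (uncurryThree f)) (t x y : ℝ) :
    HasDerivAt (fun x' => f t x' y) (fderiv ℝ (uncurryThree f) (t, x, y) (0, 1, 0)) x :=
  HasFDerivAt.comp_hasDerivAt (f := fun x' => (t, x', y)) x (hf (t, x, y)).hasFDerivAt
    ((hasDerivAt_const x t).prodMk ((hasDerivAt_id x).prodMk (hasDerivAt_const x y)))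

lemma hasDerivAt_thd_of_differentiable (hf : Differentiable ℝ (uncurryThree f)) (t x y : ℝ) :
    HasDerivAt (fun y' => f t x y') (fderiv ℝ (uncurryThree f) (t, x, y) (0, 0, 1)) y :=
  HasFDerivAt.comp_hasDerivAt (f := fun y' => (t, x, y')) y (hf (t, x, y)).hasFDerivAt
    ((hasDerivAt_const y t).prodMk ((hasDerivAt_const y x).prodMk (hasDerivAt_id y)))

lemma uncurryThree_pdt (hf : Differentiable ℝ (uncurryThree f)) :
    uncurryThree (pdt f) = fun q => fderiv ℝ (uncurryThree f) q (1, 0, 0) :=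
  funext fun ⟨t, x, y⟩ => (hasDerivAt_fst_of_differentiable hf t x y).deriv

lemma uncurryThree_pdx (hf : Differentiable ℝ (uncurryThree f)) :
    uncurryThree (pdx f) = fun q => fderiv ℝ (uncurryThree f) q (0, 1, 0) :=
  funext fun ⟨t, x, y⟩ => (hasDerivAt_snd_of_differentiable hf t x y).deriv

lemma uncurryThree_pdy (hf : Differentiable ℝ (uncurryThree f)) :
    uncurryThree (pdy f) = fun q => fderiv ℝ (uncurryThree f) q (0, 0, 1) :=
  funext fun ⟨t, x, y⟩ => (hasDerivAt_thd_of_differentiable hf t x y).deriv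

lemma differentiable_of_contDiff_top (hf : ContDiff ℝ (⊤ : ℕ∞) (uncurryThree f)) :
    Differentiable ℝ (uncurryThree f) :=
  hf.differentiable (by simp)

lemma contDiff_fderiv_apply_const {F : ℝ × ℝ × ℝ → ℝ} (hF : ContDiff ℝ (⊤ : ℕ∞) F)
    (w : ℝ × ℝ × ℝ) : ContDiff ℝ (⊤ : ℕ∞) (fun q => fderiv ℝ F q w) :=
  (hF.fderiv_right (m := (⊤ : ℕ∞)) (by simp)).clm_apply contDiff_const

lemma fderiv_fderiv_apply_comm {F : ℝ × ℝ × ℝ → ℝ} (hF : ContDiff ℝ (⊤ : ℕ∞) F)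
    (q w z : ℝ × ℝ × ℝ) :
    fderiv ℝ (fun r => fderiv ℝ F r w) q z = fderiv ℝ (fun r => fderiv ℝ F r z) q w := by
  have hd : DifferentiableAt ℝ (fderiv ℝ F) q :=
    (hF.fderiv_right (m := (⊤ : ℕ∞)) (by simp)).differentiable (by simp) q
  have hsymm : IsSymmSndFDerivAt ℝ F q :=
    hF.contDiffAt.isSymmSndFDerivAt (by simpa using WithTop.coe_le_coe.2 (le_top (a := (2 : ℕ∞))))
  rw [fderiv_clm_apply hd (differentiableAt_const w), fderiv_clm_apply hd (differentiableAt_const z)]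
  simpa using hsymm.eq z w

lemma contDiff_pdt (hf : ContDiff ℝ (⊤ : ℕ∞) (uncurryThree f)) :
    ContDiff ℝ (⊤ : ℕ∞) (uncurryThree (pdt f)) := by
  rw [uncurryThree_pdt (differentiable_of_contDiff_top hf)]
  exact contDiff_fderiv_apply_const hf _

lemma contDiff_pdx (hf : ContDiff ℝ (⊤ : ℕ∞) (uncurryThree f)) :
    ContDiff ℝ (⊤ : ℕ∞) (uncurryThree (pdx f)) := by
  rw [uncurryThree_pdx (differentiable_of_contDiff_top hf)]
  exact contDiff_fderiv_apply_const hf _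

lemma contDiff_pdy (hf : ContDiff ℝ (⊤ : ℕ∞) (uncurryThree f)) :
    ContDiff ℝ (⊤ : ℕ∞) (uncurryThree (pdy f)) := by
  rw [uncurryThree_pdy (differentiable_of_contDiff_top hf)]
  exact contDiff_fderiv_apply_const hf _

lemma hasDerivAt_pdt (hf : ContDiff ℝ (⊤ : ℕ∞) (uncurryThree f)) (t x y : ℝ) :
    HasDerivAt (fun t' => f t' x y) (pdt f t x y) t :=
  (hasDerivAt_fst_of_differentiable
    (differentiable_of_contDiff_top hf) t x y).differentiableAt.hasDerivAt

lemma hasDerivAt_pdx (hf : ContDiff ℝ (⊤ : ℕ∞) (uncurryThree f)) (t x y : ℝ) :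
    HasDerivAt (fun x' => f t x' y) (pdx f t x y) x :=
  (hasDerivAt_snd_of_differentiable
    (differentiable_of_contDiff_top hf) t x y).differentiableAt.hasDerivAt

lemma hasDerivAt_pdy (hf : ContDiff ℝ (⊤ : ℕ∞) (uncurryThree f)) (t x y : ℝ) :
    HasDerivAt (fun y' => f t x y') (pdy f t x y) y :=
  (hasDerivAt_thd_of_differentiable
    (differentiable_of_contDiff_top hf) t x y).differentiableAt.hasDerivAt

lemma pdt_pdx_comm (hf : ContDiff ℝ (⊤ : ℕ∞) (uncurryThree f)) :
    pdt (pdx f) = pdx (pdt f) := by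
  have hd := differentiable_of_contDiff_top hf
  funext t x y
  rw [← uncurryThree_mk (pdt (pdx f)), ← uncurryThree_mk (pdx (pdt f)),
    uncurryThree_pdt (differentiable_of_contDiff_top (contDiff_pdx hf)),
    uncurryThree_pdx (differentiable_of_contDiff_top (contDiff_pdt hf)),
    uncurryThree_pdt hd, uncurryThree_pdx hd]
  exact fderiv_fderiv_apply_comm hf _ _ _

lemma pdt_pdy_comm (hf : ContDiff ℝ (⊤ : ℕ∞) (uncurryThree f)) :
    pdt (pdy f) = pdy (pdt f) := by
  have hd := differentiable_of_contDiff_top hf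
  funext t x y
  rw [← uncurryThree_mk (pdt (pdy f)), ← uncurryThree_mk (pdy (pdt f)),
    uncurryThree_pdt (differentiable_of_contDiff_top (contDiff_pdy hf)),
    uncurryThree_pdy (differentiable_of_contDiff_top (contDiff_pdt hf)),
    uncurryThree_pdt hd, uncurryThree_pdy hd]
  exact fderiv_fderiv_apply_comm hf _ _ _

end PartialDerivatives

/-- Energy conservation law of the 2D generalized Boussinesq equation. -/
theorem gb_energy_conservation
    (s : ℝ) (hs : s = 1 ∨ s = -1)
    (e : ℝ) (he : e = 1 ∨ e = -1)
    (p : ℕ) (hp : 1 ≤ p)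
    (v : ℝ → ℝ → ℝ → ℝ)
    (hv : ContDiff ℝ (⊤ : ℕ∞) (fun q : ℝ × ℝ × ℝ => v q.1 q.2.1 q.2.2))
    (hsol : ∀ t x y : ℝ,
      pdt (pdt v) t x y = pdx (pdx v) t x y
        + ((p : ℝ) + 1) * (pdx v t x y) ^ p * pdx (pdx v) t x y
        + e * pdx (pdx (pdx (pdx v))) t x y + s * pdy (pdy v) t x y)
    (T X Y : ℝ → ℝ → ℝ → ℝ)
    (hT : ∀ t x y : ℝ, T t x y =
      (1/2) * ((pdt v t x y) ^ 2 - e * (pdx (pdx v) t x y) ^ 2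
        + (pdx v t x y) ^ 2 + s * (pdy v t x y) ^ 2)
        + (pdx v t x y) ^ (p+2) / ((p : ℝ) + 2))
    (hX : ∀ t x y : ℝ, X t x y =
      -((pdx v t x y) ^ (p+1) + e * pdx (pdx (pdx v)) t x y + pdx v t x y) * pdt v t x y
        + e * pdt (pdx v) t x y * pdx (pdx v) t x y)
    (hY : ∀ t x y : ℝ, Y t x y = - s * pdt v t x y * pdy v t x y) :
    ∀ t x y : ℝ, pdt T t x y + pdx X t x y + pdy Y t x y = 0 := by
  intro t x y
  replace hv : ContDiff ℝ (⊤ : ℕ∞) (uncurryThree v) := hv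
  have hvt := contDiff_pdt hv
  have hvx := contDiff_pdx hv
  have hvy := contDiff_pdy hv
  have hvxx := contDiff_pdx hvx
  have hvxxx := contDiff_pdx hvxx
  have hvtx := contDiff_pdt hvx
  have hp2 : (p : ℝ) + 2 ≠ 0 := by positivity
  have hTt : pdt T t x y = pdt v t x y * pdt (pdt v) t x y
      - e * pdx (pdx v) t x y * pdt (pdx (pdx v)) t x y
      + pdx v t x y * pdt (pdx v) t x y + s * pdy v t x y * pdt (pdy v) t x y
      + (pdx v t x y) ^ (p + 1) * pdt (pdx v) t x y := by
    have h := ((((((hasDerivAt_pdt hvt t x y).pow 2).sub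
      (((hasDerivAt_pdt hvxx t x y).pow 2).const_mul e)).add
      ((hasDerivAt_pdt hvx t x y).pow 2)).add
      (((hasDerivAt_pdt hvy t x y).pow 2).const_mul s)).const_mul (1 / 2)).add
      (((hasDerivAt_pdt hvx t x y).pow (p + 2)).div_const ((p : ℝ) + 2))
    rw [pdt, funext fun t' => hT t' x y]
    refine h.deriv.trans ?_
    push_cast
    field_simp
  have hXx : pdx X t x y =
      -(((p : ℝ) + 1) * (pdx v t x y) ^ p * pdx (pdx v) t x y
          + e * pdx (pdx (pdx (pdx v))) t x y + pdx (pdx v) t x y) * pdt v t x y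
        - ((pdx v t x y) ^ (p + 1) + e * pdx (pdx (pdx v)) t x y + pdx v t x y)
          * pdx (pdt v) t x y
        + e * pdx (pdt (pdx v)) t x y * pdx (pdx v) t x y
        + e * pdt (pdx v) t x y * pdx (pdx (pdx v)) t x y := by
    have h := ((((((hasDerivAt_pdx hvx t x y).pow (p + 1)).add
      ((hasDerivAt_pdx hvxxx t x y).const_mul e)).add
      (hasDerivAt_pdx hvx t x y)).neg).mul (hasDerivAt_pdx hvt t x y)).add
      (((hasDerivAt_pdx hvtx t x y).const_mul e).mul (hasDerivAt_pdx hvxx t x y))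
    rw [pdx, funext fun x' => hX t x' y]
    refine h.deriv.trans ?_
    simp
    ring
  have hYy : pdy Y t x y =
      -s * pdy (pdt v) t x y * pdy v t x y - s * pdt v t x y * pdy (pdy v) t x y := by
    have h := ((hasDerivAt_pdy hvt t x y).const_mul (-s)).mul (hasDerivAt_pdy hvy t x y)
    rw [pdy, funext fun y' => hY t x y']
    refine h.deriv.trans ?_
    ring
  rw [hTt, hXx, hYy, hsol, pdt_pdx_comm hvx, pdt_pdx_comm hv, pdt_pdy_comm hv]
  ring
end

section
/- Let s ∈ {1,−1}, e ∈ {1,−1}, let p be a positive integer, and let v : ℝ³ → ℝ be a smooth function of (t,x,y) solving the 2D gB potential equation v_{tt} = v_{xx} + (p+1)(v_x)^p v_{xx} + e·v_{xxxx} + s·v_{yy} at every point. Define T = (1/2)y·(v_t² − e·v_{xx}² + v_x² + s·v_y²) + s·t·v_y·v_t + y·v_x^{p+2}/(p+2), X = −(s·t·v_y + y·v_t)·(e·v_{xxx} + v_x + v_x^{p+1}) + e·(s·t·v_{xy} + y·v_{tx})·v_{xx}, Y = s·t·v_x^{p+2}/(p+2) − s·((1/2)t·(e·v_{xx}² + s·v_y²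 + v_t² − v_x²) + y·v_t·v_y). Then ∂_t T + ∂_x X + ∂_y Y = 0 at every point (this is the boost-momentum conservation law of the 2D generalized Boussinesq equation, arising from its boost point symmetry). -/
/-- Joint smoothness of a function of three real variables. -/
def JointlySmooth (v : ℝ → ℝ → ℝ → ℝ) : Prop :=
  ContDiff ℝ (⊤ : ℕ∞) (fun q : ℝ × ℝ × ℝ => v q.1 q.2.1 q.2.2)

/-- The directional derivative of a smooth function along a fixed vector is smooth. -/
theorem contDiff_fderiv_apply_const_s8 {E : Type*} [NormedAddCommGroup E] [NormedSpace ℝ E]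
    {f : E → ℝ} (hf : ContDiff ℝ (⊤ : ℕ∞) f) (a : E) :
    ContDiff ℝ (⊤ : ℕ∞) (fun q => fderiv ℝ f q a) :=
  (hf.fderiv_right (m := (⊤ : ℕ∞)) (by simp)).clm_apply contDiff_const

/-- Directional derivatives of a smooth function commute. -/
theorem fderiv_fderiv_apply_comm_s8 {E : Type*} [NormedAddCommGroup E] [NormedSpace ℝ E]
    {f : E → ℝ} (hf : ContDiff ℝ (⊤ : ℕ∞) f) (a b q : E) :
    fderiv ℝ (fun q => fderiv ℝ f q a) q b = fderiv ℝ (fun q => fderiv ℝ f q b) q a := by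
  have hd : DifferentiableAt ℝ (fderiv ℝ f) q :=
    ((hf.fderiv_right (m := (⊤ : ℕ∞)) (by simp)).differentiable (by simp)) q
  have happly (c d : E) :
      fderiv ℝ (fun q => fderiv ℝ f q c) q d = fderiv ℝ (fderiv ℝ f) q d c := by
    rw [fderiv_clm_apply hd (differentiableAt_const c)]
    simp
  rw [happly, happly]
  exact (hf.contDiffAt.isSymmSndFDerivAt
    (by simpa using WithTop.coe_le_coe.2 (le_top : (2 : ℕ∞) ≤ ⊤))) b a

namespace JointlySmooth

variable {v : ℝ → ℝ → ℝ → ℝ}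

theorem hasDerivAt_fderiv_t (hv : JointlySmooth v) (t x y : ℝ) :
    HasDerivAt (fun t' => v t' x y)
      (fderiv ℝ (fun q : ℝ × ℝ × ℝ => v q.1 q.2.1 q.2.2) (t, x, y) (1, 0, 0)) t :=
  (ContDiff.differentiable hv (by simp) (t, x, y)).hasFDerivAt.comp_hasDerivAt t
    (f := fun t' => (t', x, y))
    ((hasDerivAt_id t).prodMk ((hasDerivAt_const t x).prodMk (hasDerivAt_const t y)))

theorem pdt_eq_fderiv (hv : JointlySmooth v) (t x y : ℝ) :
    pdt v t x y = fderiv ℝ (fun q : ℝ × ℝ × ℝ => v q.1 q.2.1 q.2.2) (t, x, y) (1, 0, 0) :=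
  (hv.hasDerivAt_fderiv_t t x y).deriv

theorem hasDerivAt_t (hv : JointlySmooth v) (t x y : ℝ) :
    HasDerivAt (fun t' => v t' x y) (pdt v t x y) t :=
  (hv.hasDerivAt_fderiv_t t x y).differentiableAt.hasDerivAt

theorem smooth_pdt (hv : JointlySmooth v) : JointlySmooth (pdt v) := by
  simp only [JointlySmooth, hv.pdt_eq_fderiv]
  exact contDiff_fderiv_apply_const_s8 hv (1, 0, 0)

theorem hasDerivAt_fderiv_x (hv : JointlySmooth v) (t x y : ℝ) :
    HasDerivAt (fun x' => v t x' y)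
      (fderiv ℝ (fun q : ℝ × ℝ × ℝ => v q.1 q.2.1 q.2.2) (t, x, y) (0, 1, 0)) x :=
  (ContDiff.differentiable hv (by simp) (t, x, y)).hasFDerivAt.comp_hasDerivAt x
    (f := fun x' => (t, x', y))
    ((hasDerivAt_const x t).prodMk ((hasDerivAt_id x).prodMk (hasDerivAt_const x y)))

theorem pdx_eq_fderiv (hv : JointlySmooth v) (t x y : ℝ) :
    pdx v t x y = fderiv ℝ (fun q : ℝ × ℝ × ℝ => v q.1 q.2.1 q.2.2) (t, x, y) (0, 1, 0) :=
  (hv.hasDerivAt_fderiv_x t x y).deriv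

theorem hasDerivAt_x (hv : JointlySmooth v) (t x y : ℝ) :
    HasDerivAt (fun x' => v t x' y) (pdx v t x y) x :=
  (hv.hasDerivAt_fderiv_x t x y).differentiableAt.hasDerivAt

theorem smooth_pdx (hv : JointlySmooth v) : JointlySmooth (pdx v) := by
  simp only [JointlySmooth, hv.pdx_eq_fderiv]
  exact contDiff_fderiv_apply_const_s8 hv (0, 1, 0)

theorem hasDerivAt_fderiv_y (hv : JointlySmooth v) (t x y : ℝ) :
    HasDerivAt (fun y' => v t x y')
      (fderiv ℝ (fun q : ℝ × ℝ × ℝ => v q.1 q.2.1 q.2.2) (t, x, y) (0, 0, 1)) y :=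
  (ContDiff.differentiable hv (by simp) (t, x, y)).hasFDerivAt.comp_hasDerivAt y
    (f := fun y' => (t, x, y'))
    ((hasDerivAt_const y t).prodMk ((hasDerivAt_const y x).prodMk (hasDerivAt_id y)))

theorem pdy_eq_fderiv (hv : JointlySmooth v) (t x y : ℝ) :
    pdy v t x y = fderiv ℝ (fun q : ℝ × ℝ × ℝ => v q.1 q.2.1 q.2.2) (t, x, y) (0, 0, 1) :=
  (hv.hasDerivAt_fderiv_y t x y).deriv

theorem hasDerivAt_y (hv : JointlySmooth v) (t x y : ℝ) :
    HasDerivAt (fun y' => v t x y') (pdy v t x y) y :=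
  (hv.hasDerivAt_fderiv_y t x y).differentiableAt.hasDerivAt

theorem smooth_pdy (hv : JointlySmooth v) : JointlySmooth (pdy v) := by
  simp only [JointlySmooth, hv.pdy_eq_fderiv]
  exact contDiff_fderiv_apply_const_s8 hv (0, 0, 1)

theorem pdt_pdx_comm (hv : JointlySmooth v) (t x y : ℝ) :
    pdt (pdx v) t x y = pdx (pdt v) t x y := by
  rw [hv.smooth_pdx.pdt_eq_fderiv, hv.smooth_pdt.pdx_eq_fderiv]
  simp only [hv.pdt_eq_fderiv, hv.pdx_eq_fderiv]
  exact fderiv_fderiv_apply_comm_s8 hv _ _ _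

theorem pdt_pdy_comm (hv : JointlySmooth v) (t x y : ℝ) :
    pdt (pdy v) t x y = pdy (pdt v) t x y := by
  rw [hv.smooth_pdy.pdt_eq_fderiv, hv.smooth_pdt.pdy_eq_fderiv]
  simp only [hv.pdt_eq_fderiv, hv.pdy_eq_fderiv]
  exact fderiv_fderiv_apply_comm_s8 hv _ _ _

theorem pdx_pdy_comm (hv : JointlySmooth v) (t x y : ℝ) :
    pdx (pdy v) t x y = pdy (pdx v) t x y := by
  rw [hv.smooth_pdy.pdx_eq_fderiv, hv.smooth_pdx.pdy_eq_fderiv]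
  simp only [hv.pdx_eq_fderiv, hv.pdy_eq_fderiv]
  exact fderiv_fderiv_apply_comm_s8 hv _ _ _

end JointlySmooth

/-- Boost-momentum conservation law of the 2D generalized Boussinesq equation. -/
theorem gb_boost_momentum_conservation
    (s : ℝ) (hs : s = 1 ∨ s = -1)
    (e : ℝ) (he : e = 1 ∨ e = -1)
    (p : ℕ) (hp : 1 ≤ p)
    (v : ℝ → ℝ → ℝ → ℝ)
    (hv : ContDiff ℝ (⊤ : ℕ∞) (fun q : ℝ × ℝ × ℝ => v q.1 q.2.1 q.2.2))
    (hsol : ∀ t x y : ℝ,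
      pdt (pdt v) t x y = pdx (pdx v) t x y
        + ((p : ℝ) + 1) * (pdx v t x y) ^ p * pdx (pdx v) t x y
        + e * pdx (pdx (pdx (pdx v))) t x y + s * pdy (pdy v) t x y)
    (T X Y : ℝ → ℝ → ℝ → ℝ)
    (hT : ∀ t x y : ℝ, T t x y =
      (1/2) * y * ((pdt v t x y) ^ 2 - e * (pdx (pdx v) t x y) ^ 2
          + (pdx v t x y) ^ 2 + s * (pdy v t x y) ^ 2)
        + s * t * pdy v t x y * pdt v t x y
        + y * (pdx v t x y) ^ (p+2) / ((p : ℝ) + 2))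
    (hX : ∀ t x y : ℝ, X t x y =
      -(s * t * pdy v t x y + y * pdt v t x y)
          * (e * pdx (pdx (pdx v)) t x y + pdx v t x y + (pdx v t x y) ^ (p+1))
        + e * (s * t * pdy (pdx v) t x y + y * pdt (pdx v) t x y) * pdx (pdx v) t x y)
    (hY : ∀ t x y : ℝ, Y t x y =
      s * t * (pdx v t x y) ^ (p+2) / ((p : ℝ) + 2)
        - s * ((1/2) * t * (e * (pdx (pdx v) t x y) ^ 2 + s * (pdy v t x y) ^ 2
            + (pdt v t x y) ^ 2 - (pdx v t x y) ^ 2)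
          + y * pdt v t x y * pdy v t x y)) :
    ∀ t x y : ℝ, pdt T t x y + pdx X t x y + pdy Y t x y = 0 := by
  intro t x y
  replace hv : JointlySmooth v := hv
  have hp2 : (p : ℝ) + 2 ≠ 0 := by positivity
  have hTt : HasDerivAt (fun t' => T t' x y)
      (y * (pdt v t x y * pdt (pdt v) t x y - e * pdx (pdx v) t x y * pdt (pdx (pdx v)) t x y
          + pdx v t x y * pdt (pdx v) t x y + s * pdy v t x y * pdt (pdy v) t x y)
        + s * pdy v t x y * pdt v t x y + s * t * pdt (pdy v) t x y * pdt v t x y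
        + s * t * pdy v t x y * pdt (pdt v) t x y
        + y * pdx v t x y ^ (p + 1) * pdt (pdx v) t x y) t := by
    simp only [hT]
    refine HasDerivAt.congr_deriv
      (((((((hv.smooth_pdt.hasDerivAt_t t x y).fun_pow 2).fun_sub
        (((hv.smooth_pdx.smooth_pdx.hasDerivAt_t t x y).fun_pow 2).const_mul e)).fun_add
        ((hv.smooth_pdx.hasDerivAt_t t x y).fun_pow 2)).fun_add
        (((hv.smooth_pdy.hasDerivAt_t t x y).fun_pow 2).const_mul s)).const_mul
          ((1 / 2) * y)).fun_add
        ((((hasDerivAt_id' t).const_mul s).fun_mul (hv.smooth_pdy.hasDerivAt_t t x y)).fun_mul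
          (hv.smooth_pdt.hasDerivAt_t t x y)) |>.fun_add
        ((((hv.smooth_pdx.hasDerivAt_t t x y).fun_pow (p + 2)).const_mul y).div_const
          ((p : ℝ) + 2))) ?_
    rw [show p + 2 - 1 = p + 1 from rfl]
    push_cast
    field_simp
    ring
  have hXx : HasDerivAt (fun x' => X t x' y)
      (-(s * t * pdx (pdy v) t x y + y * pdx (pdt v) t x y)
          * (e * pdx (pdx (pdx v)) t x y + pdx v t x y + pdx v t x y ^ (p + 1))
        - (s * t * pdy v t x y + y * pdt v t x y)
          * (e * pdx (pdx (pdx (pdx v))) t x y + pdx (pdx v) t x y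
            + ((p : ℝ) + 1) * pdx v t x y ^ p * pdx (pdx v) t x y)
        + e * (s * t * pdx (pdy (pdx v)) t x y + y * pdx (pdt (pdx v)) t x y)
          * pdx (pdx v) t x y
        + e * (s * t * pdy (pdx v) t x y + y * pdt (pdx v) t x y)
          * pdx (pdx (pdx v)) t x y) x := by
    simp only [hX]
    refine HasDerivAt.congr_deriv
      (((((hv.smooth_pdy.hasDerivAt_x t x y).const_mul (s * t)).fun_add
        ((hv.smooth_pdt.hasDerivAt_x t x y).const_mul y)).fun_neg.fun_mul
        ((((hv.smooth_pdx.smooth_pdx.smooth_pdx.hasDerivAt_x t x y).const_mul e).fun_add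
          (hv.smooth_pdx.hasDerivAt_x t x y)).fun_add
          ((hv.smooth_pdx.hasDerivAt_x t x y).fun_pow (p + 1)))).fun_add
        (((((hv.smooth_pdx.smooth_pdy.hasDerivAt_x t x y).const_mul (s * t)).fun_add
          ((hv.smooth_pdx.smooth_pdt.hasDerivAt_x t x y).const_mul y)).const_mul e).fun_mul
          (hv.smooth_pdx.smooth_pdx.hasDerivAt_x t x y))) ?_
    rw [Nat.add_sub_cancel]
    push_cast
    ring
  have hYy : HasDerivAt (fun y' => Y t x y')
      (s * t * pdx v t x y ^ (p + 1) * pdy (pdx v) t x y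
        - s * (t * (e * pdx (pdx v) t x y * pdy (pdx (pdx v)) t x y
              + s * pdy v t x y * pdy (pdy v) t x y + pdt v t x y * pdy (pdt v) t x y
              - pdx v t x y * pdy (pdx v) t x y)
          + pdt v t x y * pdy v t x y + y * pdy (pdt v) t x y * pdy v t x y
          + y * pdt v t x y * pdy (pdy v) t x y)) y := by
    simp only [hY]
    refine HasDerivAt.congr_deriv
      (((((hv.smooth_pdx.hasDerivAt_y t x y).fun_pow (p + 2)).const_mul (s * t)).div_const
        ((p : ℝ) + 2)).fun_sub
        ((((((((hv.smooth_pdx.smooth_pdx.hasDerivAt_y t x y).fun_pow 2).const_mul e).fun_add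
          (((hv.smooth_pdy.hasDerivAt_y t x y).fun_pow 2).const_mul s)).fun_add
          ((hv.smooth_pdt.hasDerivAt_y t x y).fun_pow 2)).fun_sub
          ((hv.smooth_pdx.hasDerivAt_y t x y).fun_pow 2)).const_mul ((1 / 2) * t)).fun_add
          (((hasDerivAt_id' y).fun_mul (hv.smooth_pdt.hasDerivAt_y t x y)).fun_mul
            (hv.smooth_pdy.hasDerivAt_y t x y)) |>.const_mul s)) ?_
    rw [show p + 2 - 1 = p + 1 from rfl]
    push_cast
    field_simp
    ring
  have htxx := hv.smooth_pdx.pdt_pdx_comm t x y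
  have hxxy := hv.smooth_pdx.pdx_pdy_comm t x y
  have htx := hv.pdt_pdx_comm t x y
  have hxy := hv.pdx_pdy_comm t x y
  have hty := hv.pdt_pdy_comm t x y
  rw [show pdt T t x y = _ from hTt.deriv, show pdx X t x y = _ from hXx.deriv,
    show pdy Y t x y = _ from hYy.deriv, htxx, hxxy, htx, hxy, hty]
  linear_combination (s * t * pdy v t x y + y * pdt v t x y) * hsol t x y
end

section
/- Let s ∈ {1,−1}, e ∈ {1,−1}, let p be a positive integer, and let P : ℝ² → ℝ be a smooth function of (t,y) satisfying the linear wave equation P_{tt} = s·P_{yy} at every point. Let v : ℝ³ → ℝ be a smooth function of (t,x,y) solving the 2D gB potential equation v_{tt} = v_{xx} + (p+1)(v_x)^p v_{xx} + e·v_{xxxx} + s·v_{yy} at every point. Define T = P·v_t − P_t·v, X = −P·(e·v_{xxx} + v_x + v_x^{p+1}), Y = s·(P_y·v − P·v_y), where P and its derivatives are evaluated at (t,y). Then ∂_t T + ∂_x X + ∂_y Y = 0 at every point. (This is the infinite family of transverse-momentum conservation laws of the 2D generalized Boussinesq equation, one for each solution P of the wave equation P_{tt} = s·P_{yy}.) 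-/
/-- Partial derivative in the first variable for a function of `(t,y)`. -/
noncomputable def qdt (P : ℝ → ℝ → ℝ) (t y : ℝ) : ℝ :=
  deriv (fun t' => P t' y) t

/-- Partial derivative in the second variable for a function of `(t,y)`. -/
noncomputable def qdy (P : ℝ → ℝ → ℝ) (t y : ℝ) : ℝ :=
  deriv (fun y' => P t y') y

/-- The derivative of a smooth function along curves with constant velocity `u` passing
through each point is again smooth. -/
theorem contDiff_deriv_curve {E : Type*} [NormedAddCommGroup E] [NormedSpace ℝ E]
    {F : E → ℝ} (hF : ContDiff ℝ (⊤ : ℕ∞) F) {c : E → ℝ → E} {g : E → ℝ} {u : E}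
    (hc : ∀ q, HasDerivAt (c q) u (g q)) (hcg : ∀ q, c q (g q) = q) :
    ContDiff ℝ (⊤ : ℕ∞) (fun q => deriv (fun r => F (c q r)) (g q)) := by
  have h : (fun q => deriv (fun r => F (c q r)) (g q)) = fun q => fderiv ℝ F q u := by
    funext q
    have hd : HasFDerivAt F (fderiv ℝ F q) (c q (g q)) := by
      rw [hcg q]
      exact (hF.differentiable (by simp) q).hasFDerivAt
    exact (hd.comp_hasDerivAt (g q) (hc q)).deriv
  rw [h]
  exact (hF.fderiv_right (m := (⊤ : ℕ∞)) (by simp)).clm_apply contDiff_const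

section Smooth

variable {v : ℝ → ℝ → ℝ → ℝ} {P : ℝ → ℝ → ℝ}

theorem contDiff_pdt_s9 (hv : ContDiff ℝ (⊤ : ℕ∞) (fun q : ℝ × ℝ × ℝ => v q.1 q.2.1 q.2.2)) :
    ContDiff ℝ (⊤ : ℕ∞) (fun q : ℝ × ℝ × ℝ => pdt v q.1 q.2.1 q.2.2) :=
  contDiff_deriv_curve hv (c := fun q r => (r, q.2.1, q.2.2)) (g := fun q => q.1)
    (fun q => (hasDerivAt_id q.1).prodMk (hasDerivAt_const q.1 (q.2.1, q.2.2))) (fun _ => rfl)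

theorem contDiff_pdx_s9 (hv : ContDiff ℝ (⊤ : ℕ∞) (fun q : ℝ × ℝ × ℝ => v q.1 q.2.1 q.2.2)) :
    ContDiff ℝ (⊤ : ℕ∞) (fun q : ℝ × ℝ × ℝ => pdx v q.1 q.2.1 q.2.2) :=
  contDiff_deriv_curve hv (c := fun q r => (q.1, r, q.2.2)) (g := fun q => q.2.1)
    (fun q => (hasDerivAt_const q.2.1 q.1).prodMk
      ((hasDerivAt_id q.2.1).prodMk (hasDerivAt_const q.2.1 q.2.2))) (fun _ => rfl)

theorem contDiff_pdy_s9 (hv : ContDiff ℝ (⊤ : ℕ∞) (fun q : ℝ × ℝ × ℝ => v q.1 q.2.1 q.2.2)) :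
    ContDiff ℝ (⊤ : ℕ∞) (fun q : ℝ × ℝ × ℝ => pdy v q.1 q.2.1 q.2.2) :=
  contDiff_deriv_curve hv (c := fun q r => (q.1, q.2.1, r)) (g := fun q => q.2.2)
    (fun q => (hasDerivAt_const q.2.2 q.1).prodMk
      ((hasDerivAt_const q.2.2 q.2.1).prodMk (hasDerivAt_id q.2.2))) (fun _ => rfl)

theorem contDiff_qdt (hP : ContDiff ℝ (⊤ : ℕ∞) (fun q : ℝ × ℝ => P q.1 q.2)) :
    ContDiff ℝ (⊤ : ℕ∞) (fun q : ℝ × ℝ => qdt P q.1 q.2) :=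
  contDiff_deriv_curve hP (c := fun q r => (r, q.2)) (g := fun q => q.1)
    (fun q => (hasDerivAt_id q.1).prodMk (hasDerivAt_const q.1 q.2)) (fun _ => rfl)

theorem contDiff_qdy (hP : ContDiff ℝ (⊤ : ℕ∞) (fun q : ℝ × ℝ => P q.1 q.2)) :
    ContDiff ℝ (⊤ : ℕ∞) (fun q : ℝ × ℝ => qdy P q.1 q.2) :=
  contDiff_deriv_curve hP (c := fun q r => (q.1, r)) (g := fun q => q.2)
    (fun q => (hasDerivAt_const q.2 q.1).prodMk (hasDerivAt_id q.2)) (fun _ => rfl)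

theorem hasDerivAt_pdt_s9 (hv : ContDiff ℝ (⊤ : ℕ∞) (fun q : ℝ × ℝ × ℝ => v q.1 q.2.1 q.2.2))
    (t x y : ℝ) : HasDerivAt (fun r => v r x y) (pdt v t x y) t := by
  have h : ContDiff ℝ (⊤ : ℕ∞) (fun r : ℝ => v r x y) :=
    hv.comp (f := fun r : ℝ => (r, x, y)) (by fun_prop)
  exact (h.differentiable (by simp) t).hasDerivAt

theorem hasDerivAt_pdx_s9 (hv : ContDiff ℝ (⊤ : ℕ∞) (fun q : ℝ × ℝ × ℝ => v q.1 q.2.1 q.2.2))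
    (t x y : ℝ) : HasDerivAt (fun r => v t r y) (pdx v t x y) x := by
  have h : ContDiff ℝ (⊤ : ℕ∞) (fun r : ℝ => v t r y) :=
    hv.comp (f := fun r : ℝ => (t, r, y)) (by fun_prop)
  exact (h.differentiable (by simp) x).hasDerivAt

theorem hasDerivAt_pdy_s9 (hv : ContDiff ℝ (⊤ : ℕ∞) (fun q : ℝ × ℝ × ℝ => v q.1 q.2.1 q.2.2))
    (t x y : ℝ) : HasDerivAt (fun r => v t x r) (pdy v t x y) y := by
  have h : ContDiff ℝ (⊤ : ℕ∞) (fun r : ℝ => v t x r) :=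
    hv.comp (f := fun r : ℝ => (t, x, r)) (by fun_prop)
  exact (h.differentiable (by simp) y).hasDerivAt

theorem hasDerivAt_qdt (hP : ContDiff ℝ (⊤ : ℕ∞) (fun q : ℝ × ℝ => P q.1 q.2)) (t y : ℝ) :
    HasDerivAt (fun r => P r y) (qdt P t y) t := by
  have h : ContDiff ℝ (⊤ : ℕ∞) (fun r : ℝ => P r y) :=
    hP.comp (f := fun r : ℝ => (r, y)) (by fun_prop)
  exact (h.differentiable (by simp) t).hasDerivAt

theorem hasDerivAt_qdy (hP : ContDiff ℝ (⊤ : ℕ∞) (fun q : ℝ × ℝ => P q.1 q.2)) (t y : ℝ) :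
    HasDerivAt (fun r => P t r) (qdy P t y) y := by
  have h : ContDiff ℝ (⊤ : ℕ∞) (fun r : ℝ => P t r) :=
    hP.comp (f := fun r : ℝ => (t, r)) (by fun_prop)
  exact (h.differentiable (by simp) y).hasDerivAt

end Smooth

/-- Infinite family of transverse-momentum conservation laws of the
2D generalized Boussinesq equation, one for each solution `P` of the
linear wave equation `P_tt = s·P_yy`. -/
theorem gb_transverse_momentum_conservation
    (s : ℝ) (hs : s = 1 ∨ s = -1)
    (e : ℝ) (he : e = 1 ∨ e = -1)
    (p : ℕ) (hp : 1 ≤ p)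
    (P : ℝ → ℝ → ℝ)
    (hP : ContDiff ℝ (⊤ : ℕ∞) (fun q : ℝ × ℝ => P q.1 q.2))
    (hPwave : ∀ t y : ℝ, qdt (qdt P) t y = s * qdy (qdy P) t y)
    (v : ℝ → ℝ → ℝ → ℝ)
    (hv : ContDiff ℝ (⊤ : ℕ∞) (fun q : ℝ × ℝ × ℝ => v q.1 q.2.1 q.2.2))
    (hsol : ∀ t x y : ℝ,
      pdt (pdt v) t x y = pdx (pdx v) t x y
        + ((p : ℝ) + 1) * (pdx v t x y) ^ p * pdx (pdx v) t x y
        + e * pdx (pdx (pdx (pdx v))) t x y + s * pdy (pdy v) t x y)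
    (T X Y : ℝ → ℝ → ℝ → ℝ)
    (hT : ∀ t x y : ℝ, T t x y = P t y * pdt v t x y - qdt P t y * v t x y)
    (hX : ∀ t x y : ℝ, X t x y =
      - P t y * (e * pdx (pdx (pdx v)) t x y + pdx v t x y + (pdx v t x y) ^ (p+1)))
    (hY : ∀ t x y : ℝ, Y t x y =
      s * (qdy P t y * v t x y - P t y * pdy v t x y)) :
    ∀ t x y : ℝ, pdt T t x y + pdx X t x y + pdy Y t x y = 0 := by
  intro t x y
  have hvx := contDiff_pdx_s9 hv
  have hvxxx := contDiff_pdx_s9 (contDiff_pdx_s9 hvx)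
  have dT := ((hasDerivAt_qdt hP t y).mul (hasDerivAt_pdt_s9 (contDiff_pdt_s9 hv) t x y)).sub
    ((hasDerivAt_qdt (contDiff_qdt hP) t y).mul (hasDerivAt_pdt_s9 hv t x y))
  have dX := ((((hasDerivAt_pdx_s9 hvxxx t x y).const_mul e).add (hasDerivAt_pdx_s9 hvx t x y)).add
    ((hasDerivAt_pdx_s9 hvx t x y).pow (p + 1))).const_mul (-P t y)
  have dY := (((hasDerivAt_qdy (contDiff_qdy hP) t y).mul (hasDerivAt_pdy_s9 hv t x y)).sub
    ((hasDerivAt_qdy hP t y).mul (hasDerivAt_pdy_s9 (contDiff_pdy_s9 hv) t x y))).const_mul s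
  have eT := (dT.congr_of_eventuallyEq (.of_forall fun r => hT r x y)).deriv
  have eX := (dX.congr_of_eventuallyEq (.of_forall fun r => hX t r y)).deriv
  have eY := (dY.congr_of_eventuallyEq (.of_forall fun r => hY t x r)).deriv
  rw [pdt, pdx, pdy, eT, eX, eY, hsol, hPwave]
  push_cast
  ring
end
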